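/- For every n ≥ 1: if n is even, then Ã_n(−1,1|α) = (−1)^{n/2} ∑_{σ∈𝒜_n} α^{RLmin(σ)} as an identity of polynomials in ℤ[α], where 𝒜_n is the set of alternating (down-up) permutations σ ∈ S_n, i.e. those with σ_1 > σ_2 < σ_3 > σ_4 < ⋯; and if n is odd, then Ã_n(−1,1|α) = 0. -/

import Mathlib

/-- The letter at (1-based) position `i` of the word `w`, with the boundary
convention that positions `0` and `> w.length` carry the value `w.length + 1`
(playing the role of `+∞` for a permutation word of `{1,…,n}`). -/
def wB (w : List ℕ) (i : ℕ) : ℕ :=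
  if 1 ≤ i ∧ i ≤ w.length then w.getD (i - 1) 0 else w.length + 1

/-- The one-line word `σ_1 ⋯ σ_n` (with letters in `{1,…,n}`) of a permutation of `Fin n`. -/
def word {n : ℕ} (σ : Equiv.Perm (Fin n)) : List ℕ := List.ofFn (fun i => (σ i : ℕ) + 1)

/-- Number of descents: indices `i ∈ {1,…,n-1}` with `σ_i > σ_{i+1}`. -/
def desW (w : List ℕ) : ℕ :=
  ((Finset.Icc 1 (w.length - 1)).filter (fun i => wB w (i + 1) < wB w i)).card

/-- Number of ascents: indices `i ∈ {1,…,n-1}` with `σ_i < σ_{i+1}`. -/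
def ascW (w : List ℕ) : ℕ :=
  ((Finset.Icc 1 (w.length - 1)).filter (fun i => wB w i < wB w (i + 1))).card

/-- Position `i` is a double ascent: `σ_{i-1} < σ_i < σ_{i+1}` (boundary `σ_0 = σ_{n+1} = +∞`). -/
abbrev isDAat (w : List ℕ) (i : ℕ) : Prop := wB w (i - 1) < wB w i ∧ wB w i < wB w (i + 1)

/-- Position `i` is a double descent: `σ_{i-1} > σ_i > σ_{i+1}`. -/
abbrev isDDat (w : List ℕ) (i : ℕ) : Prop := wB w i < wB w (i - 1) ∧ wB w (i + 1) < wB w i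

/-- Position `i` is a peak: `σ_{i-1} < σ_i > σ_{i+1}`. -/
abbrev isPkat (w : List ℕ) (i : ℕ) : Prop := wB w (i - 1) < wB w i ∧ wB w (i + 1) < wB w i

/-- Position `i` is a valley: `σ_{i-1} > σ_i < σ_{i+1}`. -/
abbrev isVlat (w : List ℕ) (i : ℕ) : Prop := wB w i < wB w (i - 1) ∧ wB w i < wB w (i + 1)

/-- Position `i` holds a left-to-right minimum: `σ_j > σ_i` for all `j < i`. -/
abbrev isLRat (w : List ℕ) (i : ℕ) : Prop := ∀ j ∈ Finset.Icc 1 (i - 1), wB w i < wB w j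

/-- Position `i` holds a right-to-left minimum: `σ_j > σ_i` for all `j > i`. -/
abbrev isRLat (w : List ℕ) (i : ℕ) : Prop := ∀ j ∈ Finset.Icc (i + 1) w.length, wB w i < wB w j

/-- `da`, the number of double ascents. -/
def daW (w : List ℕ) : ℕ := ((Finset.Icc 1 w.length).filter (isDAat w)).card

/-- `dd`, the number of double descents. -/
def ddW (w : List ℕ) : ℕ := ((Finset.Icc 1 w.length).filter (isDDat w)).card

/-- `M`, the number of peaks. -/
def pkW (w : List ℕ) : ℕ := ((Finset.Icc 1 w.length).filter (isPkat w)).card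

/-- `LRmin`, the number of left-to-right minima. -/
def lrminW (w : List ℕ) : ℕ := ((Finset.Icc 1 w.length).filter (isLRat w)).card

/-- `RLmin`, the number of right-to-left minima. -/
def rlminW (w : List ℕ) : ℕ := ((Finset.Icc 1 w.length).filter (isRLat w)).card

/-- The word belongs to `PRW`: if it has an ascent, the first ascent occurs at the letter `1`. -/
abbrev isPRW (w : List ℕ) : Prop :=
  ∀ i ∈ Finset.Icc 1 (w.length - 1), wB w i < wB w (i + 1) →
    (∀ j ∈ Finset.Icc 1 (i - 1), ¬ wB w j < wB w (j + 1)) → wB w i = 1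

/-- The set `PRW_n` of permutations whose first ascent (if any) appears at the letter `1`. -/
def PRW (n : ℕ) : Finset (Equiv.Perm (Fin n)) :=
  Finset.univ.filter (fun σ => isPRW (word σ))

/-- `σ` is an alternating (down-up) permutation: `σ_1 > σ_2 < σ_3 > σ_4 < ⋯`. -/
abbrev isAlt (w : List ℕ) : Prop :=
  ∀ i ∈ Finset.Icc 1 (w.length - 1),
    (Odd i → wB w (i + 1) < wB w i) ∧ (Even i → wB w i < wB w (i + 1))

open Finset in
/-- Peeling off the first index of a filtered interval `{1,…,n+1}`. -/
theorem card_filter_Icc_one_succ (n : ℕ) (P : ℕ → Prop) [DecidablePred P] :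
    #{i ∈ Icc 1 (n + 1) | P i} = (if P 1 then 1 else 0) + #{i ∈ Icc 1 n | P (i + 1)} := by
  have h : ∀ k, Icc 1 k = (range k).map ⟨Nat.succ, Nat.succ_injective⟩ := by
    intro k
    ext i
    simp only [mem_Icc, mem_map, mem_range, Function.Embedding.coeFn_mk]
    constructor
    · intro hi
      exact ⟨i - 1, by omega, by omega⟩
    · rintro ⟨j, hj, rfl⟩
      omega
  simp only [card_filter, h, sum_map, Function.Embedding.coeFn_mk, sum_range_succ']
  simp [add_comm]

theorem wB_cons_one (a : ℕ) (w : List ℕ) : wB (a :: w) 1 = a := by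
  simp [wB]

theorem wB_cons_succ (a : ℕ) (w : List ℕ) {i : ℕ} (h : 1 ≤ i) (h' : i ≤ w.length) :
    wB (a :: w) (i + 1) = wB w i := by
  obtain ⟨k, rfl⟩ : ∃ k, i = k + 1 := ⟨i - 1, by omega⟩
  have h'' : k < w.length := h'
  simp [wB, h'']

theorem wB_eq_getElem {w : List ℕ} {i : ℕ} (h : i < w.length) : wB w (i + 1) = w[i] := by
  have h' : i + 1 ≤ w.length := h
  simp [wB, h', h]

theorem desW_nil : desW [] = 0 := rfl

theorem desW_singleton (a : ℕ) : desW [a] = 0 := rfl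

theorem desW_cons_cons (a b : ℕ) (w : List ℕ) :
    desW (a :: b :: w) = (if b < a then 1 else 0) + desW (b :: w) := by
  unfold desW
  simp only [List.length_cons, Nat.add_sub_cancel]
  rw [card_filter_Icc_one_succ]
  rw [wB_cons_succ _ _ le_rfl (by simp), wB_cons_one, wB_cons_one]
  · congr 2
    refine Finset.filter_congr fun i hi => ?_
    rw [Finset.mem_Icc] at hi
    rw [wB_cons_succ a _ (by omega) (by simp; omega), wB_cons_succ a _ (by omega) (by simp; omega)]

theorem rlminW_nil : rlminW [] = 0 := rfl

theorem isRLat_cons_succ (a : ℕ) (w : List ℕ) {i : ℕ} (h : 1 ≤ i) (h' : i ≤ w.length) :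
    isRLat (a :: w) (i + 1) ↔ isRLat w i := by
  constructor
  · intro H j hj
    rw [Finset.mem_Icc] at hj
    have := H (j + 1) (by simp; omega)
    rwa [wB_cons_succ _ _ h h', wB_cons_succ _ _ (by omega) (by omega)] at this
  · intro H j hj
    obtain ⟨k, rfl⟩ : ∃ k, j = k + 1 := ⟨j - 1, by simp at hj; omega⟩
    simp only [Finset.mem_Icc, List.length_cons] at hj
    rw [wB_cons_succ _ _ h h', wB_cons_succ _ _ (by omega) (by omega)]
    exact H k (by simp; omega)

theorem isRLat_cons_one (a : ℕ) (w : List ℕ) : isRLat (a :: w) 1 ↔ ∀ b ∈ w, a < b := by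
  constructor
  · intro H b hb
    obtain ⟨k, hk, rfl⟩ := List.getElem_of_mem hb
    have := H (k + 1 + 1) (by simp; omega)
    rwa [wB_cons_one, wB_cons_succ _ _ (by omega) hk, wB_eq_getElem hk] at this
  · intro H j hj
    obtain ⟨k, rfl⟩ : ∃ k, j = k + 1 + 1 := ⟨j - 2, by simp at hj; omega⟩
    have hk : k < w.length := by simp at hj; omega
    rw [wB_cons_one, wB_cons_succ _ _ (by omega) hk, wB_eq_getElem hk]
    exact H _ (List.getElem_mem hk)

theorem rlminW_cons (a : ℕ) (w : List ℕ) :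
    rlminW (a :: w) = (if ∀ b ∈ w, a < b then 1 else 0) + rlminW w := by
  unfold rlminW
  refine (card_filter_Icc_one_succ w.length (isRLat (a :: w))).trans ?_
  congr 1
  · simp only [isRLat_cons_one]
  · congr 1
    refine Finset.filter_congr fun i hi => ?_
    rw [Finset.mem_Icc] at hi
    exact isRLat_cons_succ a w hi.1 hi.2

/-- `AltFrom true w` says `w` alternates starting with a descent, `AltFrom false w` starting with
an ascent. -/
def AltFrom : Bool → List ℕ → Prop
  | _, [] => True
  | _, [_] => True
  | d, a :: b :: w => (if d then b < a else a < b) ∧ AltFrom (!d) (b :: w)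

theorem altFrom_iff (d : Bool) (w : List ℕ) :
    AltFrom d w ↔ ∀ i ∈ Finset.Icc 1 (w.length - 1),
      ((if d then Odd i else Even i) → wB w (i + 1) < wB w i) ∧
      ((if d then Even i else Odd i) → wB w i < wB w (i + 1)) := by
  fun_induction AltFrom d w with
  | case1 => simp
  | case2 => simp
  | case3 d a b w ih =>
    rw [ih]
    constructor
    · rintro ⟨h1, h2⟩ i hi
      simp only [Finset.mem_Icc, List.length_cons, Nat.add_sub_cancel] at hi h2
      rcases Nat.lt_or_ge i 2 with h | h
      · obtain rfl : i = 1 := by omega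
        rw [wB_cons_succ _ _ le_rfl (by simp), wB_cons_one, wB_cons_one]
        cases d <;> simp_all
      · obtain ⟨k, rfl⟩ : ∃ k, i = k + 1 := ⟨i - 1, by omega⟩
        have := h2 k (by omega)
        rw [wB_cons_succ a _ (by omega) (by simp; omega),
          wB_cons_succ a _ (by omega) (by simp; omega)]
        cases d <;> simp_all [Nat.even_add_one, Nat.odd_add_one]
    · intro H
      constructor
      · have := H 1 (by simp)
        rw [wB_cons_succ _ _ le_rfl (by simp), wB_cons_one, wB_cons_one] at this
        cases d <;> simp_all
      · intro i hi
        simp only [Finset.mem_Icc, List.length_cons, Nat.add_sub_cancel] at hi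
        have := H (i + 1) (by simp; omega)
        rw [wB_cons_succ a _ (by omega) (by simp; omega),
          wB_cons_succ a _ (by omega) (by simp; omega)] at this
        cases d <;> simp_all [Nat.even_add_one, Nat.odd_add_one]

theorem isAlt_iff_altFrom (w : List ℕ) : isAlt w ↔ AltFrom true w := by
  simp [altFrom_iff, isAlt]

theorem isAlt_nil : isAlt [] := by simp [isAlt_iff_altFrom, AltFrom]

section MinDecomposition

variable {m : ℕ} {A B : List ℕ}

theorem desW_cons_of_forall_lt (hB : ∀ b ∈ B, m < b) : desW (m :: B) = desW B := by
  cases B with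
  | nil => rfl
  | cons b B =>
    have : m < b := hB b (by simp)
    rw [desW_cons_cons, if_neg (by omega), zero_add]

theorem desW_append_min (hA : ∀ a ∈ A, m < a) (hB : ∀ b ∈ B, m < b) :
    desW (A ++ m :: B) = desW A + (if A = [] then 0 else 1) + desW B := by
  induction A with
  | nil => simp [desW_cons_of_forall_lt hB, desW_nil]
  | cons a A ih =>
    cases A with
    | nil =>
      have : m < a := hA a (by simp)
      simp [desW_cons_cons, desW_cons_of_forall_lt hB, desW_singleton, this]
    | cons a' A =>
      have := ih fun x hx => hA x (List.mem_cons_of_mem _ hx)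
      simp only [List.cons_append, desW_cons_cons] at this ⊢
      simp only [this]
      simp
      omega

theorem rlminW_append_min (hA : ∀ a ∈ A, m < a) (hB : ∀ b ∈ B, m < b) :
    rlminW (A ++ m :: B) = rlminW B + 1 := by
  induction A with
  | nil => rw [List.nil_append, rlminW_cons, if_pos hB, add_comm]
  | cons a A ih =>
    have ha : m < a := hA a (by simp)
    rw [List.cons_append, rlminW_cons, ih fun x hx => hA x (List.mem_cons_of_mem _ hx), if_neg,
      zero_add]
    exact fun h => absurd (h m (by simp)) (by omega)

theorem altFrom_cons_min (d : Bool) (hB : ∀ b ∈ B, m < b) :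
    AltFrom d (m :: B) ↔ B = [] ∨ (d = false ∧ AltFrom true B) := by
  cases B with
  | nil => simp [AltFrom]
  | cons b B =>
    have : m < b := hB b (by simp)
    cases d <;> simp [AltFrom, this, this.le]

theorem altFrom_append_min (d : Bool) (hA : ∀ a ∈ A, m < a) (hB : ∀ b ∈ B, m < b)
    (hne : A ≠ []) :
    AltFrom d (A ++ m :: B) ↔
      AltFrom d A ∧ AltFrom true B ∧ (if d then Odd A.length else Even A.length) := by
  induction A generalizing d with
  | nil => exact absurd rfl hne
  | cons a A ih =>
    cases A with
    | nil =>
      have : m < a := hA a (by simp)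
      simp only [List.cons_append, List.nil_append, AltFrom, altFrom_cons_min _ hB]
      cases d
      · simp; omega
      · simp [this]
        rintro rfl
        simp [AltFrom]
    | cons a' A =>
      have := ih (!d) (fun x hx => hA x (List.mem_cons_of_mem _ hx)) (by simp)
      simp only [List.cons_append] at this
      simp only [List.cons_append, AltFrom, this]
      cases d <;> simp [Nat.even_add_one, Nat.odd_add_one, and_assoc]

theorem isAlt_append_min (hA : ∀ a ∈ A, m < a) (hB : ∀ b ∈ B, m < b) :
    isAlt (A ++ m :: B) ↔
      (A = [] ∧ B = []) ∨ (isAlt A ∧ isAlt B ∧ Odd A.length) := by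
  simp only [isAlt_iff_altFrom]
  by_cases h : A = []
  · subst h
    simp [altFrom_cons_min _ hB]
  · simp [altFrom_append_min true hA hB h, h]

theorem wB_append_left (A B : List ℕ) {i : ℕ} (hi : i < A.length) :
    wB (A ++ B) (i + 1) = A[i] := by
  rw [wB_eq_getElem (by simp; omega), List.getElem_append_left hi]

theorem wB_append_cons (A B : List ℕ) (m : ℕ) : wB (A ++ m :: B) (A.length + 1) = m := by
  rw [wB_eq_getElem (by simp)]
  simp

theorem lt_wB_append_cons (hB : ∀ b ∈ B, m < b) {i : ℕ} (hi : A.length < i)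
    (hi' : i < (A ++ m :: B).length) : m < wB (A ++ m :: B) (i + 1) := by
  rw [wB_eq_getElem hi', List.getElem_append_right (by omega)]
  obtain ⟨k, hk⟩ : ∃ k, i - A.length = k + 1 := ⟨i - A.length - 1, by omega⟩
  simp only [hk, List.getElem_cons_succ]
  exact hB _ (List.getElem_mem _)

theorem wB_append_cons_succ_lt (hA : ∀ a ∈ A, m < a) (hp : A.Pairwise (· > ·)) {i j : ℕ}
    (hij : i < j) (hj : j ≤ A.length) :
    wB (A ++ m :: B) (j + 1) < wB (A ++ m :: B) (i + 1) := by
  rw [wB_append_left A _ (hij.trans_le hj)]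
  rcases hj.lt_or_eq with h | rfl
  · rw [wB_append_left A _ h]
    exact List.pairwise_iff_getElem.1 hp i j _ h hij
  · rw [wB_append_cons]
    exact hA _ (List.getElem_mem _)

theorem desW_of_pairwise_gt (hp : A.Pairwise (· > ·)) : desW A = A.length - 1 := by
  induction A with
  | nil => rfl
  | cons a A ih =>
    cases A with
    | nil => rfl
    | cons b A =>
      rw [List.pairwise_cons] at hp
      have hab : b < a := hp.1 b (by simp)
      rw [desW_cons_cons, ih hp.2, if_pos hab]
      simp [add_comm]

theorem lrminW_append_min (hA : ∀ a ∈ A, m < a) (hB : ∀ b ∈ B, m < b)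
    (hp : A.Pairwise (· > ·)) : lrminW (A ++ m :: B) = A.length + 1 := by
  have h : (Finset.Icc 1 (A ++ m :: B).length).filter (isLRat (A ++ m :: B)) =
      Finset.Icc 1 (A.length + 1) := by
    ext i
    rw [Finset.mem_filter, Finset.mem_Icc, Finset.mem_Icc]
    constructor
    · rintro ⟨⟨h1, h2⟩, h⟩
      refine ⟨h1, ?_⟩
      by_contra! hlt
      obtain ⟨k, rfl⟩ : ∃ k, i = k + 1 := ⟨i - 1, by omega⟩
      have h3 := h (A.length + 1) (by rw [Finset.mem_Icc]; omega)
      have h4 := lt_wB_append_cons hB (A := A) (i := k) (by omega) (by omega)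
      rw [wB_append_cons] at h3
      omega
    · rintro ⟨h1, h2⟩
      refine ⟨⟨h1, by simp; omega⟩, fun j hj => ?_⟩
      rw [Finset.mem_Icc] at hj
      obtain ⟨k, rfl⟩ : ∃ k, i = k + 1 := ⟨i - 1, by omega⟩
      obtain ⟨l, rfl⟩ : ∃ l, j = l + 1 := ⟨j - 1, by omega⟩
      exact wB_append_cons_succ_lt hA hp (by omega) (by omega)
  rw [lrminW, h, Nat.card_Icc, Nat.add_sub_cancel]

/-- A word with smallest letter `1` lies in `PRW` exactly when it decreases up to the `1`. -/
theorem isPRW_append_one (hA : ∀ a ∈ A, 1 < a) (hB : ∀ b ∈ B, 1 < b) (hnd : A.Nodup) :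
    isPRW (A ++ 1 :: B) ↔ A.Pairwise (· > ·) := by
  constructor
  · intro H
    have key : ∀ i < A.length, ¬ wB (A ++ 1 :: B) (i + 1) < wB (A ++ 1 :: B) (i + 1 + 1) := by
      intro i
      induction i using Nat.strong_induction_on with
      | _ i ih =>
        intro hi hlt
        have h1 := H (i + 1) (by simp; omega) hlt fun j hj => by
          rw [Finset.mem_Icc] at hj
          obtain ⟨k, rfl⟩ : ∃ k, j = k + 1 := ⟨j - 1, by omega⟩
          exact ih k (by omega) (by omega)
        rw [wB_append_left A _ hi] at h1
        have := hA _ (List.getElem_mem hi)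
        omega
    rw [← List.isChain_iff_pairwise, List.isChain_iff_getElem]
    intro i hi
    have h1 := key i (by omega)
    rw [wB_append_left A _ hi, wB_append_left A _ (by omega)] at h1
    have h2 : A[i] ≠ A[i + 1] := fun h => by
      have := (hnd.getElem_inj_iff).1 h
      omega
    omega
  · intro hp i hi hlt hmin
    simp only [Finset.mem_Icc, List.length_append, List.length_cons] at hi hmin
    obtain ⟨k, rfl⟩ : ∃ k, i = k + 1 := ⟨i - 1, by omega⟩
    rcases lt_trichotomy k A.length with h | rfl | h
    · exact absurd hlt (wB_append_cons_succ_lt hA hp (by omega) h).asymm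
    · exact wB_append_cons A B 1
    · refine absurd ?_ (hmin (A.length + 1) (by omega))
      rw [wB_append_cons]
      exact lt_wB_append_cons hB (by omega) (by simp; omega)

end MinDecomposition

/-- The words whose letters are exactly the elements of `S`, each used once. -/
def wordsOn (S : Finset ℕ) : Finset (List ℕ) := S.val.lists.toFinset

section WordsOn

variable {S : Finset ℕ} {w : List ℕ} {m : ℕ}

theorem mem_wordsOn : w ∈ wordsOn S ↔ w.Nodup ∧ ∀ a, a ∈ w ↔ a ∈ S := by
  rw [wordsOn, Multiset.mem_toFinset, Multiset.mem_lists_iff]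
  constructor
  · intro h
    have hn : w.Nodup := by
      have := S.nodup
      rw [h] at this
      exact this
    exact ⟨hn, fun a => by rw [← Finset.mem_val, h]; rfl⟩
  · rintro ⟨hn, h⟩
    exact (Multiset.Nodup.ext S.nodup (Multiset.coe_nodup.2 hn)).2 fun a => (h a).symm

theorem length_of_mem_wordsOn (h : w ∈ wordsOn S) : w.length = S.card := by
  obtain ⟨hn, h⟩ := mem_wordsOn.1 h
  rw [← List.toFinset_card_of_nodup hn]
  congr 1
  ext a
  simp [h]

theorem wordsOn_empty : wordsOn ∅ = {[]} := by
  ext w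
  simp only [mem_wordsOn, Finset.notMem_empty, iff_false, Finset.mem_singleton,
    ← List.eq_nil_iff_forall_not_mem]
  constructor
  · exact And.right
  · rintro rfl
    simp

/-- Splitting every word at a given letter `m`. -/
theorem sum_wordsOn_eq_sum_append_cons {M : Type*} [AddCommMonoid M] (hm : m ∈ S)
    (φ : List ℕ → M) :
    ∑ w ∈ wordsOn S, φ w = ∑ T ∈ (S.erase m).powerset, ∑ A ∈ wordsOn T,
      ∑ B ∈ wordsOn (S.erase m \ T), φ (A ++ m :: B) := by
  simp_rw [← Finset.sum_product' _ _ fun A B => φ (A ++ m :: B)]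
  rw [Finset.sum_sigma']
  symm
  refine Finset.sum_bij (fun p _ => p.2.1 ++ m :: p.2.2) ?_ ?_ ?_ ?_
  · rintro ⟨T, A, B⟩ h
    simp only [Finset.mem_sigma, Finset.mem_product, Finset.mem_powerset, mem_wordsOn] at h ⊢
    obtain ⟨hT, ⟨hA, hAT⟩, hB, hBS⟩ := h
    refine ⟨?_, ?_⟩
    · rw [List.nodup_append, List.nodup_cons]
      refine ⟨hA, ⟨by simp [hBS], hB⟩, ?_⟩
      intro a ha b hb
      rw [hAT] at ha
      have := hT ha
      simp only [List.mem_cons, hBS] at hb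
      rintro rfl
      simp_all
    · intro a
      simp only [List.mem_append, List.mem_cons, hAT, hBS, Finset.mem_sdiff, Finset.mem_erase]
      constructor
      · rintro (h | rfl | h)
        · exact Finset.mem_of_mem_erase (hT h)
        · exact hm
        · exact h.1.2
      · tauto
  · rintro ⟨T, A, B⟩ h ⟨T', A', B'⟩ h' heq
    simp only [Finset.mem_sigma, Finset.mem_product, Finset.mem_powerset, mem_wordsOn] at h h'
    obtain ⟨hT, ⟨hA, hAT⟩, hB, hBS⟩ := h
    obtain ⟨hT', ⟨hA', hAT'⟩, hB', hBS'⟩ := h'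
    have hmA : m ∉ A := fun h => by simpa using hT ((hAT m).1 h)
    have hmB : m ∉ B := fun h => by simpa using (hBS m).1 h
    obtain ⟨rfl, -, rfl⟩ := (List.append_cons_inj_of_notMem hmA hmB).1 heq
    obtain rfl : T = T' := by
      ext a
      rw [← hAT, ← hAT']
    rfl
  · intro w hw
    obtain ⟨hn, hw⟩ := mem_wordsOn.1 hw
    obtain ⟨A, B, rfl⟩ := List.append_of_mem ((hw m).2 hm)
    rw [List.nodup_append, List.nodup_cons] at hn
    obtain ⟨hA, ⟨hmB, hB⟩, hAB⟩ := hn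
    simp only [List.mem_append, List.mem_cons] at hw hAB
    refine ⟨⟨A.toFinset, A, B⟩, ?_, rfl⟩
    simp only [Finset.mem_sigma, Finset.mem_product, Finset.mem_powerset, mem_wordsOn]
    refine ⟨?_, ⟨hA, by simp⟩, hB, ?_⟩
    · intro a ha
      rw [List.mem_toFinset] at ha
      rw [Finset.mem_erase, ← hw]
      exact ⟨hAB a ha m (.inl rfl), .inl ha⟩
    · intro a
      rw [Finset.mem_sdiff, Finset.mem_erase, ← hw, List.mem_toFinset]
      constructor
      · intro ha
        refine ⟨⟨?_, .inr (.inr ha)⟩, fun h => hAB a h a (.inr ha) rfl⟩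
        rintro rfl
        exact hmB ha
      · tauto
  · rintro ⟨T, A, B⟩ h
    rfl

/-- Exactly one word on `S` is decreasing. -/
theorem sum_wordsOn_filter_pairwise_gt {M : Type*} [AddCommMonoid M] (S : Finset ℕ) (c : M) :
    ∑ w ∈ wordsOn S, (if w.Pairwise (· > ·) then c else 0) = c := by
  have hs := S.sortedGT_sort.pairwise
  rw [Finset.sum_eq_single (S.sort (· ≥ ·)), if_pos hs]
  · intro w hw hne
    rw [if_neg]
    exact fun h => hne (h.eq_of_mem_iff hs fun a => by
      rw [(mem_wordsOn.1 hw).2, Finset.mem_sort])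
  · intro h
    exact absurd (mem_wordsOn.2 ⟨S.sort_nodup _, fun a => Finset.mem_sort _⟩) h

theorem sum_perm_eq_sum_wordsOn {M : Type*} [AddCommMonoid M] {n : ℕ} (f : Fin n ↪ ℕ)
    (φ : List ℕ → M) :
    ∑ σ : Equiv.Perm (Fin n), φ (List.ofFn fun i => f (σ i)) =
      ∑ w ∈ wordsOn (Finset.univ.map f), φ w := by
  refine Finset.sum_bij (fun σ _ => List.ofFn fun i => f (σ i)) ?_ ?_ ?_ ?_
  · intro σ _
    rw [mem_wordsOn, List.nodup_ofFn]
    refine ⟨f.injective.comp σ.injective, fun a => ?_⟩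
    simp only [List.mem_ofFn, Finset.mem_map, Finset.mem_univ, true_and]
    exact σ.surjective.exists (p := fun i => f i = a) |>.symm
  · intro σ _ τ _ h
    ext1 i
    exact f.injective (congrFun (List.ofFn_injective h) i)
  · intro w hw
    have hl : n = w.length := by simpa using (length_of_mem_wordsOn hw).symm
    obtain ⟨hn, hw⟩ := mem_wordsOn.1 hw
    subst hl
    have hex : ∀ i : Fin w.length, ∃ j, f j = w[i] := fun i => by
      simpa using (hw w[i]).1 (List.getElem_mem _)
    choose g hg using hex
    have hinj : Function.Injective g := fun i j hij => by
      have : w[i] = w[j] := by rw [← hg, ← hg, hij]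
      exact Fin.ext (hn.getElem_inj_iff.1 this)
    refine ⟨Equiv.ofBijective g (Finite.injective_iff_bijective.1 hinj), Finset.mem_univ _, ?_⟩
    simp [hg]
  · intros
    rfl

end WordsOn

section WordSums

variable {R : Type*} [CommRing R] (x : R) {m : ℕ} {S : Finset ℕ}

/-- The Stirling–Eulerian sum at `-1` over the words on `S`. -/
def eulerSum (S : Finset ℕ) : R := ∑ w ∈ wordsOn S, (-1) ^ desW w * x ^ rlminW w

/-- The generating function of right-to-left minima of the alternating words on `S`. -/
def altSum (S : Finset ℕ) : R := ∑ w ∈ wordsOn S, if isAlt w then x ^ rlminW w else 0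

theorem eulerSum_empty : eulerSum x ∅ = 1 := by
  simp [eulerSum, wordsOn_empty, desW_nil, rlminW_nil]

theorem altSum_empty : altSum x ∅ = 1 := by
  rw [altSum, wordsOn_empty, Finset.sum_singleton, if_pos isAlt_nil, rlminW_nil, pow_zero]

theorem sum_wordsOn_insert_min {M : Type*} [AddCommMonoid M] (hm : ∀ a ∈ S, m < a)
    (φ : List ℕ → M) :
    ∑ w ∈ wordsOn (insert m S), φ w = ∑ T ∈ S.powerset, ∑ A ∈ wordsOn T,
      ∑ B ∈ wordsOn (S \ T), φ (A ++ m :: B) := by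
  rw [sum_wordsOn_eq_sum_append_cons (Finset.mem_insert_self m S),
    Finset.erase_insert fun h => (hm m h).false]

theorem forall_lt_of_mem_wordsOn {T : Finset ℕ} {A : List ℕ} (hm : ∀ a ∈ S, m < a) (hT : T ⊆ S)
    (hA : A ∈ wordsOn T) : ∀ a ∈ A, m < a :=
  fun a ha => hm a (hT (((mem_wordsOn.1 hA).2 a).1 ha))

theorem eq_nil_iff_of_mem_wordsOn {T : Finset ℕ} {A : List ℕ} (hA : A ∈ wordsOn T) :
    A = [] ↔ T = ∅ := by
  rw [← List.length_eq_zero_iff, length_of_mem_wordsOn hA, Finset.card_eq_zero]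

/-- One minus the signed count of the words on `S` by descents. -/
def tanhSum (R : Type*) [CommRing R] (S : Finset ℕ) : R :=
  if S = ∅ then 0 else -eulerSum 1 S

/-- The number of alternating words on `S` if `S` has odd size. -/
def tanSum (R : Type*) [CommRing R] (S : Finset ℕ) : R :=
  if Odd S.card then altSum 1 S else 0

theorem eulerSum_insert_min (hm : ∀ a ∈ S, m < a) :
    eulerSum x (insert m S) = x * (eulerSum x S +
      ∑ T ∈ S.powerset, tanhSum R T * eulerSum x (S \ T)) := by
  have key : ∀ T ∈ S.powerset, (∑ A ∈ wordsOn T, ∑ B ∈ wordsOn (S \ T),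
      (-1) ^ desW (A ++ m :: B) * x ^ rlminW (A ++ m :: B)) =
      x * ((if T = ∅ then eulerSum x S else 0) + tanhSum R T * eulerSum x (S \ T)) := by
    intro T hT
    rw [Finset.mem_powerset] at hT
    have h1 : ∀ A ∈ wordsOn T, ∀ B ∈ wordsOn (S \ T),
        (-1) ^ desW (A ++ m :: B) * x ^ rlminW (A ++ m :: B) =
        x * (((if T = ∅ then 1 else -1) * (-1) ^ desW A) * ((-1) ^ desW B * x ^ rlminW B)) := by
      intro A hA B hB
      have hA' := forall_lt_of_mem_wordsOn hm hT hA
      have hB' := forall_lt_of_mem_wordsOn hm Finset.sdiff_subset hB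
      rw [desW_append_min hA' hB', rlminW_append_min hA' hB']
      simp only [eq_nil_iff_of_mem_wordsOn hA]
      split_ifs <;> ring
    rw [Finset.sum_congr rfl fun A hA => Finset.sum_congr rfl (h1 A hA)]
    simp_rw [← Finset.mul_sum, ← Finset.sum_mul, ← Finset.mul_sum]
    by_cases h : T = ∅
    · subst h
      simp [tanhSum, eulerSum, wordsOn_empty, desW_nil]
    · simp [tanhSum, eulerSum, h]
  rw [eulerSum, sum_wordsOn_insert_min hm, Finset.sum_congr rfl key, ← Finset.mul_sum,
    Finset.sum_add_distrib, Finset.sum_ite_eq' _ _ _, if_pos (Finset.empty_mem_powerset S)]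

theorem altSum_insert_min (hm : ∀ a ∈ S, m < a) :
    altSum x (insert m S) = x * ((if S = ∅ then 1 else 0) +
      ∑ T ∈ S.powerset, tanSum R T * altSum x (S \ T)) := by
  have key : ∀ T ∈ S.powerset, (∑ A ∈ wordsOn T, ∑ B ∈ wordsOn (S \ T),
      if isAlt (A ++ m :: B) then x ^ rlminW (A ++ m :: B) else 0) =
      x * ((if T = ∅ then (if S = ∅ then 1 else 0) else 0) +
        tanSum R T * altSum x (S \ T)) := by
    intro T hT
    rw [Finset.mem_powerset] at hT
    have h1 : ∀ A ∈ wordsOn T, ∀ B ∈ wordsOn (S \ T),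
        (if isAlt (A ++ m :: B) then x ^ rlminW (A ++ m :: B) else 0) =
        x * ((if A = [] then 1 else 0) * (if B = [] then 1 else 0) +
          (if isAlt A ∧ Odd T.card then 1 else 0) * (if isAlt B then x ^ rlminW B else 0)) := by
      intro A hA B hB
      have hA' := forall_lt_of_mem_wordsOn hm hT hA
      have hB' := forall_lt_of_mem_wordsOn hm Finset.sdiff_subset hB
      have hAT := eq_nil_iff_of_mem_wordsOn hA
      rw [rlminW_append_min hA' hB']
      simp only [isAlt_append_min hA' hB', length_of_mem_wordsOn hA]
      by_cases h : A = []
      · have hT0 : T = ∅ := hAT.1 h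
        by_cases h' : B = []
        · simp [h, h', hT0, rlminW_nil]
        · simp [h, h', hT0]
      · simp only [h, false_and, false_or, if_false]
        split_ifs <;> first | ring1 | (exfalso; tauto)
    rw [Finset.sum_congr rfl fun A hA => Finset.sum_congr rfl (h1 A hA)]
    simp_rw [← Finset.mul_sum, Finset.sum_add_distrib, ← Finset.mul_sum, ← Finset.sum_mul]
    congr 2
    · have h2 : ∀ U : Finset ℕ, ∑ A ∈ wordsOn U, (if A = [] then (1 : R) else 0) =
          if U = ∅ then 1 else 0 := by
        intro U
        split_ifs with h
        · simp [h, wordsOn_empty]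
        · refine Finset.sum_eq_zero fun A hA => if_neg ?_
          rwa [eq_nil_iff_of_mem_wordsOn hA]
      rw [h2, h2]
      by_cases h : T = ∅ <;> simp [h]
    · rw [tanSum, altSum, altSum]
      congr 1
      by_cases h : Odd T.card <;> simp [h]
  rw [altSum, sum_wordsOn_insert_min hm, Finset.sum_congr rfl key, ← Finset.mul_sum,
    Finset.sum_add_distrib, Finset.sum_ite_eq' _ _ _, if_pos (Finset.empty_mem_powerset S)]

/-- Strong induction on a finite set by removal of its minimum. -/
theorem Finset.strong_induction_insert_min {p : Finset ℕ → Prop} (h0 : p ∅)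
    (h : ∀ m S, (∀ a ∈ S, m < a) → (∀ T ⊆ S, p T) → p (insert m S)) (S : Finset ℕ) : p S := by
  induction S using Finset.strongInduction with
  | _ S ih =>
    rcases S.eq_empty_or_nonempty with rfl | hS
    · exact h0
    · rw [← Finset.insert_erase (S.min'_mem hS)]
      refine h _ _ (fun a ha => S.min'_lt_of_mem_erase_min' hS ha) fun T hT => ih T ?_
      exact hT.trans_ssubset (Finset.erase_ssubset (S.min'_mem hS))

theorem tanhSum_insert_min (hm : ∀ a ∈ S, m < a) :
    tanhSum R (insert m S) = (if S = ∅ then -1 else 0) +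
      ∑ T ∈ S.powerset, tanhSum R T * tanhSum R (S \ T) := by
  have h : ∀ T : Finset ℕ, eulerSum (1 : R) T = (if T = ∅ then 1 else 0) - tanhSum R T := by
    intro T
    by_cases hT : T = ∅ <;> simp [tanhSum, hT, eulerSum_empty]
  have h1 : tanhSum R (insert m S) = -eulerSum 1 (insert m S) := by simp [tanhSum]
  have h2 : ∑ T ∈ S.powerset, tanhSum R T * (if S \ T = ∅ then 1 else 0) = tanhSum R S := by
    rw [Finset.sum_eq_single S]
    · simp
    · intro T hT hne
      rw [if_neg, mul_zero]
      rw [Finset.sdiff_eq_empty_iff_subset]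
      exact fun h => hne ((Finset.mem_powerset.1 hT).antisymm h)
    · simp
  rw [h1, eulerSum_insert_min 1 hm]
  simp_rw [h, mul_sub, Finset.sum_sub_distrib, h2]
  split_ifs <;> ring

theorem tanSum_of_even (h : Even S.card) : tanSum R S = 0 :=
  if_neg (Nat.not_odd_iff_even.2 h)

theorem tanhSum_eq (S : Finset ℕ) : tanhSum R S = (-1) ^ ((S.card + 1) / 2) * tanSum R S := by
  induction S using Finset.strong_induction_insert_min with
  | h0 => simp [tanhSum, tanSum]
  | h m S hm ih =>
    have hcard : (insert m S).card = S.card + 1 :=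
      Finset.card_insert_of_notMem fun h => (hm m h).false
    have key : ∀ T ∈ S.powerset, tanhSum R T * tanhSum R (S \ T) =
        (-1) ^ ((S.card + 1 + 1) / 2) *
          (if Odd (S.card + 1) then tanSum R T * altSum 1 (S \ T) else 0) := by
      intro T hT
      rw [Finset.mem_powerset] at hT
      have hc := Finset.card_sdiff_add_card_eq_card hT
      rw [ih T hT, ih _ Finset.sdiff_subset]
      rcases Nat.even_or_odd T.card with h | h
      · simp [tanSum_of_even h]
      · obtain ⟨k, hk⟩ := h
        rcases Nat.even_or_odd (S \ T).card with h' | h'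
        · rw [tanSum_of_even h', if_neg]
          · simp
          · rw [Nat.not_odd_iff_even]
            grind
        · rw [if_pos (by grind)]
          conv_lhs => rw [tanSum.eq_def R (S \ T), if_pos h']
          obtain ⟨l, hl⟩ := h'
          have e1 : (S.card + 1 + 1) / 2 = (T.card + 1) / 2 + ((S \ T).card + 1) / 2 := by omega
          rw [e1]
          ring
    rw [tanhSum_insert_min hm, Finset.sum_congr rfl key, tanSum, altSum_insert_min 1 hm, hcard]
    by_cases h : S = ∅
    · subst h
      simp [tanSum]
    · split_ifs <;> simp [Finset.mul_sum]

/-- The sum over pairs of a decreasing word and an arbitrary word, jointly on `S`. -/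
def binomialEulerSum (S : Finset ℕ) : R :=
  ∑ T ∈ S.powerset, (-x) ^ T.card * eulerSum x (S \ T)

theorem binomialEulerSum_insert_min (hm : ∀ a ∈ S, m < a) :
    binomialEulerSum x (insert m S) =
      x * ∑ T ∈ S.powerset, tanhSum R T * binomialEulerSum x (S \ T) := by
  have hmS : m ∉ S := fun h => (hm m h).false
  have h1 : ∀ T ∈ S.powerset, (-x) ^ T.card * eulerSum x (insert m S \ T) =
      x * ((-x) ^ T.card * eulerSum x (S \ T)) + x * ∑ U ∈ (S \ T).powerset,
        tanhSum R U * ((-x) ^ T.card * eulerSum x ((S \ T) \ U)) := by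
    intro T hT
    rw [Finset.mem_powerset] at hT
    rw [Finset.insert_sdiff_of_notMem _ fun h => hmS (hT h),
      eulerSum_insert_min x fun a ha => hm a (Finset.sdiff_subset ha)]
    simp only [mul_left_comm _ ((-x) ^ T.card), ← Finset.mul_sum]
    ring
  have h2 : ∀ T ∈ S.powerset, (-x) ^ (insert m T).card * eulerSum x (insert m S \ insert m T) =
      -(x * ((-x) ^ T.card * eulerSum x (S \ T))) := by
    intro T hT
    rw [Finset.mem_powerset] at hT
    rw [Finset.card_insert_of_notMem fun h => hmS (hT h), Finset.insert_sdiff_insert,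
      Finset.sdiff_insert_of_notMem hmS]
    ring
  rw [binomialEulerSum, Finset.sum_powerset_insert hmS, Finset.sum_congr rfl h1,
    Finset.sum_congr rfl h2, Finset.sum_add_distrib, Finset.sum_neg_distrib,
    add_neg_cancel_comm, ← Finset.mul_sum]
  congr 1
  simp_rw [binomialEulerSum, Finset.mul_sum]
  rw [Finset.sum_comm' (t' := S.powerset) (s' := fun U => (S \ U).powerset)]
  · simp_rw [sdiff_right_comm]
  · intro T U
    simp only [Finset.mem_powerset, Finset.subset_sdiff]
    tauto

/-- Both sides vanish for odd `S.card` and carry the sign `(-1) ^ (S.card / 2)` otherwise. -/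
theorem binomialEulerSum_eq (S : Finset ℕ) : binomialEulerSum x S =
    if Even S.card then (-1) ^ (S.card / 2) * altSum x S else 0 := by
  induction S using Finset.strong_induction_insert_min with
  | h0 => simp [binomialEulerSum, eulerSum_empty, altSum_empty]
  | h m S hm ih =>
    have hcard : (insert m S).card = S.card + 1 :=
      Finset.card_insert_of_notMem fun h => (hm m h).false
    have key : ∀ T ∈ S.powerset, tanhSum R T * binomialEulerSum x (S \ T) =
        if Even (S.card + 1) then
          (-1) ^ ((S.card + 1) / 2) * (tanSum R T * altSum x (S \ T)) else 0 := by
      intro T hT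
      rw [Finset.mem_powerset] at hT
      have hc := Finset.card_sdiff_add_card_eq_card hT
      rw [tanhSum_eq, ih _ Finset.sdiff_subset]
      rcases Nat.even_or_odd T.card with h | h
      · simp [tanSum_of_even h]
      · obtain ⟨k, hk⟩ := h
        rcases Nat.even_or_odd (S \ T).card with h' | h'
        · rw [if_pos h', if_pos (by grind)]
          obtain ⟨l, hl⟩ := h'
          have e1 : (S.card + 1) / 2 = (T.card + 1) / 2 + (S \ T).card / 2 := by omega
          rw [e1]
          ring
        · rw [if_neg (Nat.not_even_iff_odd.2 h'), if_neg, mul_zero]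
          rw [Nat.not_even_iff_odd]
          grind
    rw [binomialEulerSum_insert_min x hm, Finset.sum_congr rfl key, altSum_insert_min x hm, hcard]
    by_cases h : S = ∅
    · subst h
      simp
    · split_ifs
      · simp only [zero_add, ← Finset.mul_sum]
        ring
      · simp

theorem sum_wordsOn_insert_one_isPRW (h1 : ∀ a ∈ S, 1 < a) :
    ∑ w ∈ wordsOn (insert 1 S), (if isPRW w then
      (-1) ^ desW w * 1 ^ ascW w * x ^ (lrminW w + rlminW w - 2) else 0) =
    binomialEulerSum x S := by
  rw [sum_wordsOn_insert_min h1, binomialEulerSum]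
  refine Finset.sum_congr rfl fun T hT => ?_
  rw [Finset.mem_powerset] at hT
  have key : ∀ A ∈ wordsOn T, (∑ B ∈ wordsOn (S \ T), if isPRW (A ++ 1 :: B) then
      (-1) ^ desW (A ++ 1 :: B) * 1 ^ ascW (A ++ 1 :: B) *
        x ^ (lrminW (A ++ 1 :: B) + rlminW (A ++ 1 :: B) - 2) else 0) =
      if A.Pairwise (· > ·) then (-x) ^ T.card * eulerSum x (S \ T) else 0 := by
    intro A hA
    have hA' := forall_lt_of_mem_wordsOn h1 hT hA
    have hT0 := eq_nil_iff_of_mem_wordsOn hA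
    have hl := length_of_mem_wordsOn hA
    split_ifs with h
    · rw [eulerSum, Finset.mul_sum]
      refine Finset.sum_congr rfl fun B hB => ?_
      have hB' := forall_lt_of_mem_wordsOn h1 Finset.sdiff_subset hB
      rw [if_pos ((isPRW_append_one hA' hB' (mem_wordsOn.1 hA).1).2 h), one_pow,
        desW_append_min hA' hB', rlminW_append_min hA' hB', lrminW_append_min hA' hB' h,
        desW_of_pairwise_gt h]
      have e1 : A.length - 1 + (if A = [] then 0 else 1) = T.card := by
        rw [← hl]
        cases A <;> simp
      have e2 : A.length + 1 + (rlminW B + 1) - 2 = T.card + rlminW B := by omega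
      rw [e1, e2, neg_pow x]
      ring
    · refine Finset.sum_eq_zero fun B hB => if_neg ?_
      have hB' := forall_lt_of_mem_wordsOn h1 Finset.sdiff_subset hB
      rwa [isPRW_append_one hA' hB' (mem_wordsOn.1 hA).1]
  rw [Finset.sum_congr rfl key, sum_wordsOn_filter_pairwise_gt]

end WordSums

theorem rlminW_map_succ (w : List ℕ) : rlminW (w.map (· + 1)) = rlminW w := by
  induction w with
  | nil => rfl
  | cons a w ih => simp [rlminW_cons, ih]

theorem altFrom_map_succ (d : Bool) (w : List ℕ) : AltFrom d (w.map (· + 1)) ↔ AltFrom d w := by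
  fun_induction AltFrom d w with
  | case1 => simp [AltFrom]
  | case2 => simp [AltFrom]
  | case3 d a b w ih =>
    rw [← ih]
    simp [AltFrom]

/-- The embedding `i ↦ i + k` of `Fin n` into `ℕ`. -/
def finShift (n k : ℕ) : Fin n ↪ ℕ := ⟨fun i => i + k, fun i j h => Fin.ext (by simpa using h)⟩

theorem finShift_apply (n k : ℕ) (i : Fin n) : finShift n k i = i + k := rfl

theorem altSum_map_finShift_two {R : Type*} [CommRing R] (x : R) (n : ℕ) :
    altSum x (Finset.univ.map (finShift n 2)) =
      ∑ σ ∈ (Finset.univ : Finset (Equiv.Perm (Fin n))).filter (fun σ => isAlt (word σ)),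
        x ^ rlminW (word σ) := by
  rw [altSum, ← sum_perm_eq_sum_wordsOn, Finset.sum_filter]
  refine Finset.sum_congr rfl fun σ _ => ?_
  have h : (List.ofFn fun i => finShift n 2 (σ i)) = (word σ).map (· + 1) := by
    simp only [word, List.map_ofFn]
    rfl
  rw [h, rlminW_map_succ]
  refine if_congr ?_ rfl rfl
  rw [isAlt_iff_altFrom, altFrom_map_succ, isAlt_iff_altFrom]

theorem map_finShift_one (n : ℕ) : Finset.univ.map (finShift (n + 1) 1) =
    insert 1 (Finset.univ.map (finShift n 2)) := by
  ext a
  simp only [Finset.mem_map, Finset.mem_univ, true_and, Finset.mem_insert, Fin.exists_fin_succ,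
    finShift_apply, Fin.val_zero, Fin.val_succ, zero_add, add_assoc, Nat.reduceAdd, eq_comm]

theorem sum_PRW_succ {R : Type*} [CommRing R] (x : R) (n : ℕ) :
    ∑ σ ∈ PRW (n + 1), (-1 : R) ^ desW (word σ) * 1 ^ ascW (word σ) *
        x ^ (lrminW (word σ) + rlminW (word σ) - 2) =
      if Even n then (-1) ^ (n / 2) *
        ∑ σ ∈ (Finset.univ : Finset (Equiv.Perm (Fin n))).filter (fun σ => isAlt (word σ)),
          x ^ rlminW (word σ)
      else 0 := by
  have h1 : ∀ a ∈ Finset.univ.map (finShift n 2), 1 < a := by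
    simp [finShift_apply]
  have h2 := binomialEulerSum_eq x (Finset.univ.map (finShift n 2))
  rw [← sum_wordsOn_insert_one_isPRW x h1, ← map_finShift_one, ← sum_perm_eq_sum_wordsOn,
    altSum_map_finShift_two, Finset.card_map, Finset.card_univ, Fintype.card_fin] at h2
  rw [← h2, PRW, Finset.sum_filter]
  rfl

/-- `Ã_n(-1,1|α)` vanishes for odd `n` and equals
`(-1)^{n/2} ∑_{σ ∈ 𝒜_n} α^{RLmin σ}` for even `n`, in `ℤ[α]`. -/
theorem binomialStirlingEulerian_at_neg_one (n : ℕ) (hn : 1 ≤ n) :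
    (Even n →
      ∑ σ ∈ PRW (n + 1), (-1 : Polynomial ℤ) ^ desW (word σ) * 1 ^ ascW (word σ) *
          Polynomial.X ^ (lrminW (word σ) + rlminW (word σ) - 2)
        = (-1 : Polynomial ℤ) ^ (n / 2) *
            ∑ σ ∈ (Finset.univ : Finset (Equiv.Perm (Fin n))).filter
                (fun σ => isAlt (word σ)),
              Polynomial.X ^ rlminW (word σ)) ∧
    (Odd n →
      ∑ σ ∈ PRW (n + 1), (-1 : Polynomial ℤ) ^ desW (word σ) * 1 ^ ascW (word σ) *
          Polynomial.X ^ (lrminW (word σ) + rlminW (word σ) - 2) = 0) := by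
  rw [sum_PRW_succ]
  exact ⟨fun h => if_pos h, fun h => if_neg (Nat.not_even_iff_odd.2 h)⟩
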